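/- Let σ be a regular automorphism of A with σ(S_i) = n·S_i for each i = 1, …, n, and let F be the fixed-point algebra of σ. Then for all words μ, ν the matrix u_{μ,ν} = [[1 − P_μ, S_μ S_ν*],[S_ν S_μ*, 1 − P_ν]] ∈ M₂(A) is a self-adjoint unitary satisfying the modular condition: both u_{μ,ν}·σ(u_{μ,ν}*) and u_{μ,ν}*·σ(u_{μ,ν}) lie in M₂(F). -/

import Mathlib

/-- The product `S_μ = S_{μ₁} ⋯ S_{μ_k}` of a Cuntz family along a word `μ`. -/
def cuntzWord {A : Type*} [Monoid A] {n : ℕ} (S : Fin n → A) (w : List (Fin n)) : A :=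
  (w.map S).prod

theorem star_cuntzWord_mul_self {A : Type*} [Ring A] [StarRing A] {n : ℕ} (S : Fin n → A)
    (hS : ∀ i, star (S i) * S i = 1) (w : List (Fin n)) :
    star (cuntzWord S w) * cuntzWord S w = 1 := by
  induction w with
  | nil => simp [cuntzWord]
  | cons i w ih =>
    have h : cuntzWord S (i :: w) = S i * cuntzWord S w := by simp [cuntzWord]
    rw [h, star_mul, mul_assoc, ← mul_assoc (star (S i)), hS, one_mul, ih]

theorem map_cuntzWord {R A : Type*} [CommSemiring R] [Semiring A] [Algebra R A] {n : ℕ}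
    (S : Fin n → A) (σ : A ≃ₐ[R] A) (c : R) (hσ : ∀ i, σ (S i) = c • S i) (w : List (Fin n)) :
    σ (cuntzWord S w) = c ^ w.length • cuntzWord S w := by
  induction w with
  | nil => simp [cuntzWord]
  | cons i w ih =>
    have h : cuntzWord S (i :: w) = S i * cuntzWord S w := by simp [cuntzWord]
    rw [h, map_mul, hσ, ih, smul_mul_smul_comm, List.length_cons, pow_succ']

/-- A regular automorphism acts on the adjoint of an eigenvector with real eigenvalue by the
inverse eigenvalue. -/
theorem map_star_eq_inv_smul {A : Type*} [Ring A] [Algebra ℂ A] [StarRing A] [StarModule ℂ A]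
    (σ : A ≃ₐ[ℂ] A) (hreg : ∀ a : A, star (σ a) = σ.symm (star a)) {s : A} {c : ℂ}
    (hc : c ≠ 0) (hreal : star c = c) (hs : σ s = c • s) : σ (star s) = c⁻¹ • star s := by
  have h := congrArg σ (hreg s)
  rw [AlgEquiv.apply_symm_apply, hs, star_smul, hreal, map_smul] at h
  exact (inv_smul_eq_iff₀ hc).2 h.symm |>.symm

/-- For isometries `s`, `t`, the product of the matrix `[[1 - ss*, st*], [ts*, 1 - tt*]]` with its
rescaling along the off-diagonal is diagonal. -/
theorem cuntz_matrix_mul_rescaled {R A : Type*} [CommRing R] [Ring A] [Algebra R A] [StarRing A]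
    {s t : A} (hs : star s * s = 1) (ht : star t * t = 1) (c d : R) :
    !![1 - s * star s, s * star t; t * star s, 1 - t * star t] *
      !![1 - s * star s, c • (s * star t); d • (t * star s), 1 - t * star t] =
    !![1 - s * star s + d • (s * star s), 0; 0, 1 - t * star t + c • (t * star t)] := by
  have mul_cancel {v : A} (hv : star v * v = 1) (x y : A) :
      x * star v * (v * y) = x * y := by
    rw [mul_assoc, ← mul_assoc (star v), hv, one_mul]
  rw [Matrix.mul_fin_two]
  simp only [mul_sub, sub_mul, mul_one, one_mul, mul_smul_comm, mul_cancel hs, mul_cancel ht,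
    sub_self, sub_zero, add_zero, smul_zero, add_comm (c • _)]

/-- for a regular automorphism `σ` with `σ(S_i) = n S_i`, each matrix
`u_{μ,ν} = [[1 - P_μ, S_μ S_ν^*],[S_ν S_μ^*, 1 - P_ν]]` is a self-adjoint unitary
satisfying the modular condition: all entries of `u σ(u^*)` and of `u^* σ(u)` are
fixed by `σ` (i.e. lie in the fixed-point algebra `F`). -/
theorem stmt_7 {A : Type*} [Ring A] [Algebra ℂ A] [StarRing A] [StarModule ℂ A]
    {n : ℕ} (hn : 2 ≤ n) (S : Fin n → A)
    (hS1 : ∀ i j, star (S i) * S j = if i = j then 1 else 0)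
    (hS2 : ∑ i, S i * star (S i) = 1)
    (σ : A ≃ₐ[ℂ] A) (hreg : ∀ a : A, star (σ a) = σ.symm (star a))
    (hσS : ∀ i, σ (S i) = (n : ℂ) • S i) :
    ∀ μ ν : List (Fin n), ∀ u : Matrix (Fin 2) (Fin 2) A,
      u = !![1 - cuntzWord S μ * star (cuntzWord S μ),
              cuntzWord S μ * star (cuntzWord S ν);
              cuntzWord S ν * star (cuntzWord S μ),
              1 - cuntzWord S ν * star (cuntzWord S ν)] →
      star u = u ∧ u * u = 1 ∧
      (∀ i j, σ ((u * (star u).map (⇑σ)) i j) = (u * (star u).map (⇑σ)) i j) ∧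
      (∀ i j, σ ((star u * u.map (⇑σ)) i j) = (star u * u.map (⇑σ)) i j) := by
  intro μ ν u hu
  have hn0 : (n : ℂ) ≠ 0 := by exact_mod_cast (by omega : n ≠ 0)
  have hiso := star_cuntzWord_mul_self S (fun i => by simp [hS1])
  have hσ := map_cuntzWord S σ n hσS
  have hσstar (w : List (Fin n)) := map_star_eq_inv_smul σ hreg (pow_ne_zero w.length hn0)
    (by simp) (hσ w)
  have hstar : star u = u := by
    subst hu
    ext i j
    fin_cases i <;> fin_cases j <;> simp [Matrix.star_apply]
  have hsq : u * u = 1 := by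
    have h := cuntz_matrix_mul_rescaled (hiso μ) (hiso ν) (1 : ℂ) 1
    simp only [one_smul, sub_add_cancel] at h
    rw [hu, h, Matrix.one_fin_two]
  have hfix (w : List (Fin n)) :
      σ (cuntzWord S w * star (cuntzWord S w)) = cuntzWord S w * star (cuntzWord S w) := by
    rw [map_mul, hσ, hσstar, smul_mul_smul_comm, mul_inv_cancel₀ (pow_ne_zero _ hn0), one_smul]
  have hmod : ∀ i j, σ ((u * u.map (⇑σ)) i j) = (u * u.map (⇑σ)) i j := by
    have hmap : u.map (⇑σ) =
        !![1 - cuntzWord S μ * star (cuntzWord S μ),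
            ((n : ℂ) ^ μ.length * ((n : ℂ) ^ ν.length)⁻¹) •
              (cuntzWord S μ * star (cuntzWord S ν));
          ((n : ℂ) ^ ν.length * ((n : ℂ) ^ μ.length)⁻¹) •
              (cuntzWord S ν * star (cuntzWord S μ)),
            1 - cuntzWord S ν * star (cuntzWord S ν)] := by
      subst hu
      ext i j
      fin_cases i <;> fin_cases j <;>
        simp only [Matrix.map_apply, Matrix.of_apply, Matrix.cons_val', Matrix.cons_val_zero,
          Matrix.cons_val_one, Matrix.cons_val_fin_one, Fin.zero_eta, Fin.mk_one, map_sub,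
          map_one, hfix, map_mul, hσ, hσstar, smul_mul_smul_comm]
    rw [hmap, hu, cuntz_matrix_mul_rescaled (hiso μ) (hiso ν)]
    intro i j
    fin_cases i <;> fin_cases j <;> simp [-map_mul, hfix]
  rw [hstar]
  exact ⟨rfl, hsq, hmod, hmod⟩
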